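/- Let A be the companion matrix of f(x) = (x-1)³(x²−x+1) and B the companion matrix of g(x) = (x+1)(x⁴+1), and set T = B·A⁻¹ in GL(5,ℚ). Then T² = I with T ≠ I, B has order 8 and no power of B equals −I, and the hypergeometric group Γ(f,g) = ⟨A,B⟩ is the free product of the subgroup generated by T and the subgroup generated by B: the canonical group homomorphism from the abstract free product (ℤ/2ℤ) ∗ (ℤ/8ℤ) to GL(5,ℚ) sending the generator of ℤ/2ℤ to T and the generator of ℤ/8ℤ to B is injective with image Γ(f,g). -/

import Mathlib

open Polynomial Matrix

/-- The companion matrix of a monic degree-5 rational polynomial `p`: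
the `5 × 5` matrix whose entries in position `(i+1, i)` equal `1` for
`i = 1, ..., 4`, whose last column is `(-p₀, -p₁, -p₂, -p₃, -p₄)ᵀ`
(where `pᵢ` is the coefficient of `xⁱ` in `p`), and whose remaining
entries are `0`. -/
def companionMatrix (p : ℚ[X]) : Matrix (Fin 5) (Fin 5) ℚ :=
  Matrix.of fun i j : Fin 5 =>
    if (j : ℕ) = 4 then -p.coeff i
    else if (i : ℕ) = (j : ℕ) + 1 then 1 else 0

/-- The ping-pong lemma for the free product of two groups, one of which has at least three
elements. -/
theorem Monoid.Coprod.lift_injective_of_ping_pong {F : Bool → Type} [∀ b, Group (F b)]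
    {K α : Type} [Group K] [MulAction K α] (k : ∀ b, F b →* K) (X Y : Set α)
    (hX : X.Nonempty) (hY : Y.Nonempty) (hXY : Disjoint X Y)
    (hf : ∀ a : F false, a ≠ 1 → ∀ y ∈ Y, k false a • y ∈ X)
    (hg : ∀ b : F true, b ≠ 1 → ∀ x ∈ X, k true b • x ∈ Y) (hcard : 3 ≤ Cardinal.mk (F true)) :
    Function.Injective (Monoid.Coprod.lift (k false) (k true)) := by
  let Z : Bool → Set α := fun b => Bool.rec X Y b
  have hk : Function.Injective (Monoid.CoprodI.lift k) := by
    refine Monoid.CoprodI.lift_injective_of_ping_pong k (Or.inr ⟨true, hcard⟩) Z ?_ ?_ ?_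
    · rintro (_ | _)
      exacts [hX, hY]
    · rintro (_ | _) (_ | _) hij
      exacts [absurd rfl hij, hXY, hXY.symm, absurd rfl hij]
    · rintro (_ | _) (_ | _) hij a ha
      · exact absurd rfl hij
      · rintro _ ⟨y, hy, rfl⟩
        exact hf a ha y hy
      · rintro _ ⟨x, hx, rfl⟩
        exact hg a ha x hx
      · exact absurd rfl hij
  let ψ : Monoid.Coprod (F false) (F true) →* Monoid.CoprodI F :=
    Monoid.Coprod.lift (Monoid.CoprodI.of (M := F) (i := false))
      (Monoid.CoprodI.of (M := F) (i := true))
  let θ : Monoid.CoprodI F →* Monoid.Coprod (F false) (F true) :=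
    Monoid.CoprodI.lift fun b => by
      cases b
      exacts [Monoid.Coprod.inl, Monoid.Coprod.inr]
  have hθψ : θ.comp ψ = MonoidHom.id _ := by
    apply Monoid.Coprod.hom_ext <;> ext a
    · simp [θ, ψ]
    · simp [θ, ψ]
  have hψ : Function.Injective ψ :=
    Function.LeftInverse.injective (g := θ) fun x => DFunLike.congr_fun hθψ x
  have hlift : Monoid.Coprod.lift (k false) (k true) = (Monoid.CoprodI.lift k).comp ψ := by
    apply Monoid.Coprod.hom_ext <;> ext a
    · simp [ψ]
    · simp [ψ]
  rw [hlift]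
  exact hk.comp hψ

/-- An element `g` with `g ^ n = 1` is the image of the generator under a homomorphism from
the cyclic group of order `n`. -/
theorem exists_zmod_hom_of_pow_eq_one {G : Type*} [Group G] (n : ℕ) (g : G) (hg : g ^ n = 1) :
    ∃ φ : Multiplicative (ZMod n) →* G, ∀ k : ℤ, φ (Multiplicative.ofAdd (k : ZMod n)) = g ^ k := by
  refine ⟨AddMonoidHom.toMultiplicativeLeft (ZMod.lift n ⟨zmultiplesHom (Additive G)
    (Additive.ofMul g), ?_⟩), fun k => ?_⟩
  · simpa using congrArg Additive.ofMul hg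
  · change Additive.toMul (ZMod.lift n _ (k : ZMod n)) = g ^ k
    rw [ZMod.lift_coe]
    simp

namespace Case19

/-- The quadratic form of signature `(1, 4)` preserved by the hypergeometric group. -/
def lorentzForm (x : Fin 5 → ℚ) : ℚ :=
  -71 * (x 0 ^ 2 + x 1 ^ 2 + x 2 ^ 2 + x 3 ^ 2 + x 4 ^ 2)
    - 98 * (x 0 * x 1 + x 1 * x 2 + x 2 * x 3 + x 3 * x 4)
    + 2 * (x 0 * x 2 + x 1 * x 3 + x 2 * x 4) + 94 * (x 0 * x 3 + x 1 * x 4) + 146 * (x 0 * x 4)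

/-- Pairing with the timelike eigenvector of `B`; it fixes the time orientation. -/
def timeForm (x : Fin 5 → ℚ) : ℚ := x 0 - x 1 + x 2 - x 3 + x 4

/-- Pairing with the normal of the wall of the ping-pong half-space. -/
def wallForm (x : Fin 5 → ℚ) : ℚ := 5 * x 0 + 3 * x 1 + x 2 - x 3 - 3 * x 4

/-- The half-space of hyperbolic 4-space, as a set of timelike vectors, used as ping-pong
region of the involution. -/
def halfSpace : Set (Fin 5 → ℚ) := {x | 0 < lorentzForm x ∧ wallForm x * timeForm x < 0}

/-- The action of `B` on column vectors. -/
def actB (x : Fin 5 → ℚ) : Fin 5 → ℚ := ![-x 4, x 0 - x 4, x 1, x 2, x 3 - x 4]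

/-- The action of `T` on column vectors. -/
def actT (x : Fin 5 → ℚ) : Fin 5 → ℚ :=
  ![-x 0, x 1 + 3 * x 0, x 2 - 7 * x 0, x 3 + 7 * x 0, x 4 - 5 * x 0]

theorem lorentzForm_actB (x : Fin 5 → ℚ) : lorentzForm (actB x) = lorentzForm x := by
  simp [lorentzForm, actB]
  ring

theorem lorentzForm_iterate_actB (n : ℕ) (x : Fin 5 → ℚ) :
    lorentzForm (actB^[n] x) = lorentzForm x := by
  induction n with
  | zero => rfl
  | succ n ih => rw [Function.iterate_succ_apply', lorentzForm_actB, ih]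

theorem lorentzForm_actT (x : Fin 5 → ℚ) : lorentzForm (actT x) = lorentzForm x := by
  simp [lorentzForm, actT]
  ring

theorem wallForm_actT (x : Fin 5 → ℚ) : wallForm (actT x) = wallForm x := by
  simp [wallForm, actT]
  ring

theorem timeForm_mul_pos (x : Fin 5 → ℚ) (hx : 0 < lorentzForm x) : 0 < timeForm x * x 0 := by
  unfold lorentzForm at hx
  unfold timeForm
  linarith [sq_nonneg (75 * x 0 + 47 * x 1 + x 2 - 49 * x 3 - 71 * x 4),
    sq_nonneg (779 * x 1 + 907 * x 2 + 557 * x 3 - 47 * x 4),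
    sq_nonneg (476 * x 2 + 489 * x 3 + 93 * x 4),
    sq_nonneg (45 * x 3 + 29 * x 4),
    sq_nonneg (x 4)]

/-- The translates of the half-space by nontrivial powers of `B` lie on the other side of its
wall. -/
theorem wallForm_mul_timeForm_iterate_pos (x : Fin 5 → ℚ) (hx : x ∈ halfSpace) (n : ℕ)
    (hn : 0 < n) (hn8 : n < 8) : 0 < wallForm (actB^[n] x) * timeForm (actB^[n] x) := by
  obtain ⟨hq, hw⟩ := hx
  unfold lorentzForm at hq
  unfold wallForm timeForm at hw
  interval_cases n <;> simp [wallForm, timeForm, actB]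
  · linarith [sq_nonneg (73 * x 0 + 49 * x 1 + x 2 - 47 * x 3 - 71 * x 4),
      sq_nonneg (659 * x 1 + 882 * x 2 + 521 * x 3 + 12 * x 4),
      sq_nonneg (114 * x 2 + 157 * x 3 + 15 * x 4),
      sq_nonneg (x 3 + 3 * x 4)]
  · linarith [sq_nonneg (77 * x 0 + 47 * x 1 + x 2 - 53 * x 3 - 71 * x 4),
      sq_nonneg (388 * x 1 + 485 * x 2 + 321 * x 3 - 16 * x 4),
      sq_nonneg (x 2 + x 3),
      sq_nonneg (14 * x 3 - x 4),
      sq_nonneg (x 4)]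
  · linarith [sq_nonneg (77 * x 0 + 49 * x 1 + 5 * x 2 - 51 * x 3 - 71 * x 4),
      sq_nonneg (31 * x 1 + 42 * x 2 + 27 * x 3 + 2 * x 4),
      sq_nonneg (33 * x 2 + 19 * x 3 + 6 * x 4),
      sq_nonneg (6 * x 3 - x 4),
      sq_nonneg (x 4)]
  · linarith [sq_nonneg (73 * x 0 + 47 * x 1 + x 2 - 49 * x 3 - 71 * x 4),
      sq_nonneg (130 * x 1 + 141 * x 2 + 99 * x 3 - 10 * x 4),
      sq_nonneg (123 * x 2 + 67 * x 3 + 30 * x 4),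
      sq_nonneg (22 * x 3 - 3 * x 4),
      sq_nonneg (x 4)]
  · linarith [sq_nonneg (81 * x 0 + 45 * x 1 + 5 * x 2 - 55 * x 3 - 71 * x 4),
      sq_nonneg (99 * x 1 + 104 * x 2 + 71 * x 3 - 8 * x 4),
      sq_nonneg (448 * x 2 + 283 * x 3 + 95 * x 4),
      sq_nonneg (69 * x 3 + x 4),
      sq_nonneg (x 4)]
  · linarith [sq_nonneg (77 * x 0 + 47 * x 1 + 5 * x 2 - 49 * x 3 - 71 * x 4),
      sq_nonneg (388 * x 1 + 423 * x 2 + 259 * x 3 - 16 * x 4),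
      sq_nonneg (465 * x 2 + 337 * x 3 + 120 * x 4),
      sq_nonneg (46 * x 3 + 15 * x 4),
      sq_nonneg (x 4)]
  · linarith [sq_nonneg (77 * x 0 + 45 * x 1 + x 2 - 51 * x 3 - 71 * x 4),
      sq_nonneg (899 * x 1 + 932 * x 2 + 593 * x 3 - 106 * x 4),
      sq_nonneg (88 * x 2 + 83 * x 3 + 17 * x 4),
      sq_nonneg (x 3 + x 4)]

/-- `T` maps timelike vectors on the far side of the wall into the half-space. -/
theorem actT_mem_halfSpace (x : Fin 5 → ℚ) (hq : 0 < lorentzForm x)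
    (hx : 0 < wallForm x * timeForm x) : actT x ∈ halfSpace := by
  have h₁ := timeForm_mul_pos x hq
  have hq' : 0 < lorentzForm (actT x) := by rwa [lorentzForm_actT]
  have h₂ : 0 < timeForm (actT x) * -x 0 := timeForm_mul_pos (actT x) hq'
  refine ⟨hq', ?_⟩
  rw [wallForm_actT]
  have hneg : timeForm (actT x) * timeForm x < 0 := by
    by_contra! h
    nlinarith [mul_pos h₁ h₂, mul_nonneg h (sq_nonneg (x 0))]
  by_contra! h
  nlinarith [mul_nonneg h hx.le, mul_pos_of_neg_of_neg hneg hneg,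
    mul_nonneg (sq_nonneg (wallForm x)) (neg_nonneg.2 hneg.le),
    mul_pos (sq_pos_of_ne_zero (left_ne_zero_of_mul hx.ne')) (neg_pos.2 hneg)]

theorem companionMatrix_g :
    companionMatrix ((X + 1) * (X ^ 4 + 1)) =
      !![0, 0, 0, 0, -1; 1, 0, 0, 0, -1; 0, 1, 0, 0, 0; 0, 0, 1, 0, 0; 0, 0, 0, 1, -1] := by
  have h : ((X + 1) * (X ^ 4 + 1) : ℚ[X]) = X ^ 5 + X ^ 4 + X + 1 := by ring
  ext i j
  fin_cases i <;> fin_cases j <;> simp [companionMatrix, h, coeff_X, coeff_one]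

theorem companionMatrix_f :
    companionMatrix ((X - 1) ^ 3 * (X ^ 2 - X + 1)) =
      !![0, 0, 0, 0, 1; 1, 0, 0, 0, -4; 0, 1, 0, 0, 7; 0, 0, 1, 0, -7; 0, 0, 0, 1, 4] := by
  have h : ((X - 1) ^ 3 * (X ^ 2 - X + 1) : ℚ[X]) =
      X ^ 5 - C 4 * X ^ 4 + C 7 * X ^ 3 - C 7 * X ^ 2 + C 4 * X - 1 := by
    simp only [map_ofNat]
    ring
  ext i j
  fin_cases i <;> fin_cases j <;>
    simp [companionMatrix, h, coeff_X, coeff_one]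

end Case19

open Case19

/-- `Γ(f,g) = ⟨T⟩ ∗ ⟨B⟩` for `f = ((X - 1) ^ 3 * (X ^ 2 - X + 1))`, `g = ((X + 1) * (X ^ 4 + 1))`. -/
theorem hypergeometric_free_product_case19 (A B T : GL (Fin 5) ℚ)
    (hA : (↑A : Matrix (Fin 5) (Fin 5) ℚ) = companionMatrix ((X - 1) ^ 3 * (X ^ 2 - X + 1)))
    (hB : (↑B : Matrix (Fin 5) (Fin 5) ℚ) = companionMatrix ((X + 1) * (X ^ 4 + 1)))
    (hT : T = B * A⁻¹) :
    T ^ 2 = 1 ∧ T ≠ 1 ∧ orderOf B = 8 ∧ (∀ i : ℤ, B ^ i ≠ -1) ∧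
    ∃ φ : Monoid.Coprod (Multiplicative (ZMod 2)) (Multiplicative (ZMod 8)) →* GL (Fin 5) ℚ,
      φ (Monoid.Coprod.inl (Multiplicative.ofAdd (1 : ZMod 2))) = T ∧
      φ (Monoid.Coprod.inr (Multiplicative.ofAdd (1 : ZMod 8))) = B ∧
      Function.Injective φ ∧
      φ.range = Subgroup.closure {A, B} := by
  rw [companionMatrix_f] at hA
  rw [companionMatrix_g] at hB
  have hTA : T * A = B := by rw [hT, inv_mul_cancel_right]
  have hTm : (↑T : Matrix (Fin 5) (Fin 5) ℚ) =
      !![-1, 0, 0, 0, 0; 3, 1, 0, 0, 0; -7, 0, 1, 0, 0; 7, 0, 0, 1, 0; -5, 0, 0, 0, 1] := by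
    have hA' : IsUnit (↑A : Matrix (Fin 5) (Fin 5) ℚ) := A.isUnit
    apply hA'.mul_right_cancel
    rw [← Units.val_mul, hTA, hA, hB]
    ext i j
    fin_cases i <;> fin_cases j <;> norm_num [Matrix.mul_apply, Fin.sum_univ_succ]
  have hT2 : T ^ 2 = 1 := by
    ext i j
    rw [Units.val_pow_eq_pow_val, hTm]
    fin_cases i <;> fin_cases j <;> norm_num [pow_two, Matrix.mul_apply, Fin.sum_univ_succ]
  have hT1 : T ≠ 1 := by
    intro h
    have := congrArg (fun M : GL (Fin 5) ℚ => M.1 0 0) h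
    rw [hTm] at this
    norm_num at this
  have hB4 : ((B ^ 4 : GL (Fin 5) ℚ) : Matrix (Fin 5) (Fin 5) ℚ) =
      !![0, -1, 1, -1, 1; 0, -1, 0, 0, 0; 0, 0, -1, 0, 0; 0, 0, 0, -1, 0; 1, -1, 1, -1, 0] := by
    rw [Units.val_pow_eq_pow_val, hB]
    ext i j
    fin_cases i <;> fin_cases j <;> norm_num [pow_succ, Matrix.mul_apply, Fin.sum_univ_succ]
  have hB8 : B ^ 8 = 1 := by
    ext i j
    rw [show (8 : ℕ) = 4 * 2 from rfl, pow_mul, Units.val_pow_eq_pow_val, hB4]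
    fin_cases i <;> fin_cases j <;> norm_num [pow_two, Matrix.mul_apply, Fin.sum_univ_succ]
  have hB4ne : B ^ 4 ≠ 1 := by
    intro h
    have := congrArg (fun M : GL (Fin 5) ℚ => M.1 0 0) h
    rw [hB4] at this
    norm_num at this
  have hord : orderOf B = 8 := orderOf_eq_prime_pow (p := 2) (n := 2) hB4ne hB8
  refine ⟨hT2, hT1, hord, ?_, ?_⟩
  · intro i hi
    have h2 : B ^ (2 * i) = 1 := by rw [mul_comm, _root_.zpow_mul, hi]; simp
    have hdvd := orderOf_dvd_iff_zpow_eq_one.2 h2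
    rw [hord] at hdvd
    obtain ⟨k, rfl⟩ : (4 : ℤ) ∣ i := by omega
    have hB4z : B ^ (4 * k) = (B ^ 4) ^ k := by rw [_root_.zpow_mul]; rfl
    have h4 : (B ^ 4) ^ 2 = 1 := by rw [← pow_mul, hB8]
    have hne : (1 : GL (Fin 5) ℚ) ≠ -1 := by
      intro h
      have := congrArg (fun M : GL (Fin 5) ℚ => M.1 0 0) h
      norm_num at this
    rw [hB4z] at hi
    rcases Int.even_or_odd' k with ⟨m, rfl | rfl⟩
    · rw [_root_.zpow_mul, zpow_ofNat, h4, _root_.one_zpow] at hi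
      exact hne hi
    · rw [_root_.zpow_add, _root_.zpow_mul, zpow_ofNat, h4, _root_.one_zpow, one_mul, zpow_one] at hi
      have := congrArg (fun M : GL (Fin 5) ℚ => M.1 0 0) hi
      rw [hB4] at this
      norm_num at this
  obtain ⟨f, hf⟩ := exists_zmod_hom_of_pow_eq_one 2 T hT2
  obtain ⟨g, hg⟩ := exists_zmod_hom_of_pow_eq_one 8 B hB8
  have hf1 : f (Multiplicative.ofAdd 1) = T := by simpa using hf 1
  have hg1 : g (Multiplicative.ofAdd 1) = B := by simpa using hg 1
  let _ : MulAction (GL (Fin 5) ℚ) (Fin 5 → ℚ) :=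
    { smul := fun M x => M.1 *ᵥ x
      one_smul := Matrix.one_mulVec
      mul_smul := fun M N x => (Matrix.mulVec_mulVec x M.1 N.1).symm }
  have hTact (x : Fin 5 → ℚ) : T • x = actT x := by
    change T.1 *ᵥ x = actT x
    rw [hTm]
    ext i
    fin_cases i <;> simp [actT, Matrix.mulVec, dotProduct, Fin.sum_univ_succ] <;> ring
  have hBact (x : Fin 5 → ℚ) : B • x = actB x := by
    change B.1 *ᵥ x = actB x
    rw [hB]
    ext i
    fin_cases i <;> simp [actB, Matrix.mulVec, dotProduct, Fin.sum_univ_succ] <;> ring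
  have hBpow (n : ℕ) (x : Fin 5 → ℚ) : B ^ n • x = actB^[n] x := by
    induction n with
    | zero => simp
    | succ n ih => rw [pow_succ', mul_smul, ih, hBact, Function.iterate_succ_apply']
  have hfne (a : Multiplicative (ZMod 2)) (ha : a ≠ 1) : f a = T := by
    have : a = Multiplicative.ofAdd 1 := by
      revert a
      decide
    rw [this, hf1]
  have hgne (b : Multiplicative (ZMod 8)) (hb : b ≠ 1) : ∃ n, 0 < n ∧ n < 8 ∧ g b = B ^ n := by
    let z : ZMod 8 := Multiplicative.toAdd b
    refine ⟨z.val, Nat.pos_of_ne_zero fun h => hb ((ZMod.val_eq_zero z).1 h), z.val_lt, ?_⟩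
    have := hg z.val
    rwa [Int.cast_natCast, ZMod.natCast_zmod_val, zpow_natCast] at this
  let Y : Set (Fin 5 → ℚ) := {y | ∃ n, 0 < n ∧ n < 8 ∧ ∃ x ∈ halfSpace, y = actB^[n] x}
  have hhalf : (![-1, 3, -7, 7, -4] : Fin 5 → ℚ) ∈ halfSpace := by
    constructor <;> simp [lorentzForm, wallForm, timeForm] <;> norm_num
  refine ⟨Monoid.Coprod.lift f g, by rw [Monoid.Coprod.lift_apply_inl, hf1],
    by rw [Monoid.Coprod.lift_apply_inr, hg1], ?_, ?_⟩
  · let k : ∀ b : Bool, Multiplicative (ZMod (bif b then 8 else 2)) →* GL (Fin 5) ℚ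
      | false => f
      | true => g
    refine Monoid.Coprod.lift_injective_of_ping_pong k halfSpace Y ⟨_, hhalf⟩
      ⟨_, 1, one_pos, by norm_num, _, hhalf, rfl⟩ ?_ ?_ ?_ ?_
    · rw [Set.disjoint_left]
      rintro _ hy ⟨n, hn, hn8, x, hx, rfl⟩
      exact (wallForm_mul_timeForm_iterate_pos x hx n hn hn8).not_gt hy.2
    · rintro a ha _ ⟨n, hn, hn8, x, hx, rfl⟩
      rw [hfne a ha, hTact]
      exact actT_mem_halfSpace _ (by rw [lorentzForm_iterate_actB]; exact hx.1)
        (wallForm_mul_timeForm_iterate_pos x hx n hn hn8)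
    · intro b hb x hx
      obtain ⟨n, hn, hn8, hgb⟩ := hgne b hb
      exact ⟨n, hn, hn8, x, hx, by rw [hgb, hBpow]⟩
    · have : Cardinal.mk (Multiplicative (ZMod 8)) = 8 := by
        rw [Cardinal.mk_fintype]
        simp
      change 3 ≤ Cardinal.mk (Multiplicative (ZMod 8))
      rw [this]
      norm_num
  · rw [Monoid.Coprod.range_lift]
    apply le_antisymm
    · have hAm : A ∈ Subgroup.closure {A, B} := Subgroup.subset_closure (by simp)
      have hBm : B ∈ Subgroup.closure {A, B} := Subgroup.subset_closure (by simp)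
      have hTmem : T ∈ Subgroup.closure {A, B} := hT ▸ mul_mem hBm (inv_mem hAm)
      refine sup_le ?_ ?_
      · rintro _ ⟨a, rfl⟩
        by_cases ha : a = 1
        · rw [ha, map_one]
          exact one_mem _
        · rwa [hfne a ha]
      · rintro _ ⟨b, rfl⟩
        by_cases hb : b = 1
        · rw [hb, map_one]
          exact one_mem _
        · obtain ⟨n, -, -, hgb⟩ := hgne b hb
          rw [hgb]
          exact pow_mem hBm n
    · have hTm' : T ∈ f.range ⊔ g.range := Subgroup.mem_sup_left ⟨_, hf1⟩
      have hBm' : B ∈ f.range ⊔ g.range := Subgroup.mem_sup_right ⟨_, hg1⟩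
      rw [Subgroup.closure_le]
      rintro _ (rfl | rfl)
      · rw [SetLike.mem_coe, eq_inv_mul_of_mul_eq hTA]
        exact mul_mem (inv_mem hTm') hBm'
      · exact hBm'
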